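/- For every integer n ≥ 1, the number of pairs (k, m) of positive integers satisfying T_n + T_k = T_m equals the number of odd divisors d > 1 of n(n+1) (= 2T_n). -/

import Mathlib

/-- The triangular number `T m = m(m+1)/2`. -/
def T (m : ℕ) : ℕ := m * (m + 1) / 2

theorem two_mul_T (m : ℕ) : 2 * T m = m * (m + 1) :=
  Nat.mul_div_cancel' (Nat.even_mul_succ_self m).two_dvd

theorem T_add_T_eq_T_iff {n k m : ℕ} :
    T n + T k = T m ↔ n * (n + 1) + k * (k + 1) = m * (m + 1) := by
  rw [← two_mul_T, ← two_mul_T, ← two_mul_T]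
  omega

/-- The odd one of the two consecutive numbers `n` and `n + 1`. -/
def oddFactor (n : ℕ) : ℕ := if Even n then n + 1 else n

theorem odd_oddFactor (n : ℕ) : Odd (oddFactor n) := by
  unfold oddFactor
  split_ifs with h
  · exact h.add_one
  · exact Nat.not_even_iff_odd.mp h

theorem oddFactor_dvd (n : ℕ) : oddFactor n ∣ n * (n + 1) := by
  unfold oddFactor
  split_ifs
  · exact dvd_mul_left _ _
  · exact dvd_mul_right _ _

theorem eq_oddFactor {n d : ℕ} (hd : Odd d) (h : d = n ∨ d = n + 1) : d = oddFactor n := by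
  unfold oddFactor
  split_ifs with hn
  · rcases h with rfl | h
    · exact absurd hn (Nat.not_even_iff_odd.mpr hd)
    · exact h
  · rcases h with h | rfl
    · exact h
    · exact absurd (Nat.not_even_iff_odd.mp hn).add_one (Nat.not_even_iff_odd.mpr hd)

theorem oddFactor_eq_or (n : ℕ) : oddFactor n = n ∨ oddFactor n = n + 1 := by
  unfold oddFactor
  split_ifs <;> simp

/-- The pair `(k, m)` with `{m - k, m + k + 1} = {d, q}`, for `d` and `q` of opposite parity. -/
def pairOfFactors (d q : ℕ) : ℕ × ℕ := ((max d q - min d q - 1) / 2, (d + q - 1) / 2)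

theorem pairOfFactors_comm (d q : ℕ) : pairOfFactors d q = pairOfFactors q d := by
  simp only [pairOfFactors, max_comm, min_comm, add_comm]

theorem pairOfFactors_add (a k : ℕ) : pairOfFactors a (a + 2 * k + 1) = (k, a + k) := by
  simp only [pairOfFactors, Prod.mk.injEq]
  omega

theorem even_div_of_odd {n d : ℕ} (hd : Odd d) (h : d ∣ n * (n + 1)) :
    Even (n * (n + 1) / d) := by
  have he := Nat.even_mul_succ_self n
  rw [← Nat.mul_div_cancel' h, Nat.even_mul] at he
  exact he.resolve_left (Nat.not_even_iff_odd.mpr hd)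

theorem pairOfFactors_injOn (n : ℕ) :
    Set.InjOn (fun d => pairOfFactors d (n * (n + 1) / d)) {d | d ∣ n * (n + 1) ∧ Odd d} := by
  rintro d ⟨hd, hdo⟩ d' ⟨hd', hdo'⟩ h
  have hq := even_div_of_odd hdo hd
  have hq' := even_div_of_odd hdo' hd'
  have hm := Nat.mul_div_cancel' hd
  have hm' := Nat.mul_div_cancel' hd'
  simp only [pairOfFactors, Prod.mk.injEq] at h
  generalize n * (n + 1) / d = q at *
  generalize n * (n + 1) / d' = q' at *
  have hs : d + q = d' + q' := by
    have := hdo.add_even hq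
    have := hdo'.add_even hq'
    grind
  have hp : ((d : ℤ) - d') * (d - q') = 0 := by
    have hs' : (d : ℤ) + q = d' + q' := by exact_mod_cast hs
    have hp' : (d : ℤ) * q = d' * q' := by exact_mod_cast hm.trans hm'.symm
    linear_combination (d : ℤ) * hs' - hp'
  rcases mul_eq_zero.mp hp with h0 | h0
  · omega
  · have : d = q' := by omega
    exact absurd hq' (Nat.not_even_iff_odd.mpr (this ▸ hdo))

theorem eq_of_mul_succ_eq {a n : ℕ} (h : a * (a + 1) = n * (n + 1)) : a = n := by
  rcases lt_trichotomy a n with hlt | rfl | hlt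
  · nlinarith
  · rfl
  · nlinarith

/-- A factorization of `n(n+1)` as `a(a+2k+1)` gives a solution of `T n + T k = T (a + k)`. -/
theorem T_add_T_eq_T_add_iff {n k a : ℕ} :
    T n + T k = T (a + k) ↔ a * (a + 2 * k + 1) = n * (n + 1) := by
  rw [T_add_T_eq_T_iff]
  constructor <;> intro h <;> nlinarith

theorem image_pairOfFactors {n : ℕ} (hn : 1 ≤ n) :
    (fun d => pairOfFactors d (n * (n + 1) / d)) ''
        {d | (d ∣ n * (n + 1) ∧ Odd d) ∧ d ≠ oddFactor n}
      = {p : ℕ × ℕ | 0 < p.1 ∧ 0 < p.2 ∧ T n + T p.1 = T p.2} := by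
  have hpos : 0 < n * (n + 1) := by positivity
  ext ⟨k, m⟩
  constructor
  · rintro ⟨d, ⟨⟨hd, hdo⟩, hne⟩, hp⟩
    have hq := even_div_of_odd hdo hd
    have hm := Nat.mul_div_cancel' hd
    simp only at hp
    generalize n * (n + 1) / d = q at *
    obtain ⟨a, l, hal, hprod, hpair, hda⟩ : ∃ a l, 0 < a ∧ a * (a + 2 * l + 1) = n * (n + 1) ∧
        pairOfFactors d q = (l, a + l) ∧ (d = a ∨ d = a + 2 * l + 1) := by
      have hsum := Nat.odd_iff.mp (hdo.add_even hq)
      rcases le_total d q with hle | hle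
      · obtain ⟨l, rfl⟩ : ∃ l, q = d + 2 * l + 1 := ⟨(q - d) / 2, by omega⟩
        exact ⟨d, l, hdo.pos, hm, pairOfFactors_add _ _, .inl rfl⟩
      · obtain ⟨l, rfl⟩ : ∃ l, d = q + 2 * l + 1 := ⟨(d - q) / 2, by omega⟩
        refine ⟨q, l, ?_, by rw [← hm, mul_comm], ?_, .inr rfl⟩
        · exact Nat.pos_of_ne_zero fun h0 => by simp [h0] at hm; omega
        · rw [pairOfFactors_comm, pairOfFactors_add]
    rw [hpair, Prod.mk.injEq] at hp
    obtain ⟨rfl, rfl⟩ := hp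
    refine ⟨Nat.pos_of_ne_zero ?_, by simp only; omega, T_add_T_eq_T_add_iff.mpr hprod⟩
    rintro rfl
    have han := eq_of_mul_succ_eq hprod
    exact hne (eq_oddFactor hdo (by omega))
  · rintro ⟨hk, -, h⟩
    simp only at hk h
    have hkm : k < m := by
      rw [T_add_T_eq_T_iff] at h
      by_contra! hle
      nlinarith
    obtain ⟨a, rfl⟩ := Nat.exists_eq_add_of_lt hkm
    rw [show k + a + 1 = (a + 1) + k by ring] at h ⊢
    generalize a + 1 = a at *
    rw [T_add_T_eq_T_add_iff] at h
    have ha : 0 < a := Nat.pos_of_ne_zero fun h0 => by simp [h0] at h; omega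
    have hna : a ≠ n := by
      rintro rfl
      have := Nat.eq_of_mul_eq_mul_left ha h
      omega
    have hna' : a ≠ n + 1 := by
      rintro rfl
      nlinarith
    have hnb : a + 2 * k + 1 ≠ n := fun hb => by
      rw [hb, mul_comm] at h
      have := Nat.eq_of_mul_eq_mul_left hn h
      omega
    have hnb' : a + 2 * k + 1 ≠ n + 1 := fun hb => by
      rw [hb] at h
      exact hna (Nat.eq_of_mul_eq_mul_right n.succ_pos h)
    have hor := oddFactor_eq_or n
    rcases Nat.even_or_odd a with he | ho
    · refine ⟨a + 2 * k + 1, ⟨⟨Dvd.intro_left _ h, ?_⟩, by omega⟩, ?_⟩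
      · exact (he.add (even_two_mul k)).add_one
      · simp only [← h]
        rw [Nat.mul_div_cancel _ (by omega), pairOfFactors_comm, pairOfFactors_add]
    · refine ⟨a, ⟨⟨Dvd.intro _ h, ho⟩, by omega⟩, ?_⟩
      simp only [← h]
      rw [Nat.mul_div_cancel_left _ ha, pairOfFactors_add]

/-- For every `n ≥ 1`, the number of pairs `(k, m)` of positive integers
with `T n + T k = T m` equals the number of odd divisors `d > 1` of `n(n+1) = 2 T n`. -/
theorem count_nontrivial_triples (n : ℕ) (hn : 1 ≤ n) :
    {p : ℕ × ℕ | 0 < p.1 ∧ 0 < p.2 ∧ T n + T p.1 = T p.2}.ncard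
      = ((n * (n + 1)).divisors.filter (fun d => Odd d ∧ 1 < d)).card := by
  have hpos : n * (n + 1) ≠ 0 := by positivity
  rw [← image_pairOfFactors hn,
    Set.InjOn.ncard_image ((pairOfFactors_injOn n).mono fun _ hd => hd.1)]
  set O := (n * (n + 1)).divisors.filter (fun d => Odd d) with hO
  have hleft : {d | (d ∣ n * (n + 1) ∧ Odd d) ∧ d ≠ oddFactor n} = ↑(O.erase (oddFactor n)) := by
    ext d
    simp [hO, hpos, and_comm]
  have hright : (n * (n + 1)).divisors.filter (fun d => Odd d ∧ 1 < d) = O.erase 1 := by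
    ext d
    simp only [hO, Finset.mem_filter, Finset.mem_erase]
    constructor
    · rintro ⟨h, ho, h1⟩
      exact ⟨h1.ne', h, ho⟩
    · rintro ⟨h1, h, ho⟩
      have := ho.pos
      exact ⟨h, ho, by omega⟩
  rw [hleft, hright, Set.ncard_coe_finset, Finset.card_erase_of_mem, Finset.card_erase_of_mem]
  · simp [hO, hpos]
  · simp only [hO, Finset.mem_filter, Nat.mem_divisors]
    exact ⟨⟨oddFactor_dvd n, hpos⟩, odd_oddFactor n⟩
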